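/- For every integer l ≥ 2 and every positive integer k, there exists a finite connected simple graph G with cop'_l(G) = 1 and cop_l(G) ≥ k + 1; in particular cop_l(G) - cop'_l(G) ≥ k. (Such a G may be taken to be any graph of diameter 2 whose classical cop number is at least k+1.) -/

import Mathlib

open Classical

/-- A cop at `c` sees the vertex `v` when `v` is within distance `l` of `c`. -/
def inSight {V : Type} (G : SimpleGraph V) (l : ℕ) (c v : V) : Prop :=
  G.Reachable c v ∧ G.dist c v ≤ l

/-- A legal robber trajectory: at each turn the robber stays put or moves
to an adjacent vertex. -/
def LegalRobber {V : Type} (G : SimpleGraph V) (r : ℕ → V) : Prop :=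
  ∀ t, r (t + 1) = r t ∨ G.Adj (r t) (r (t + 1))

/-- A legal sequence of cop positions: at each turn every cop stays put or
moves to an adjacent vertex. -/
def LegalCopPath {V : Type} (G : SimpleGraph V) {k : ℕ} (P : ℕ → Fin k → V) : Prop :=
  ∀ t i, P (t + 1) i = P t i ∨ G.Adj (P t i) (P (t + 1) i)

/-- The observation made by `l`-visibility cops at positions `P` when the robber
is at `rv`: they see the robber exactly when he is within distance `l` of some cop. -/
noncomputable def visObs {V : Type} (G : SimpleGraph V) (l : ℕ) {k : ℕ}
    (P : Fin k → V) (rv : V) : Option V :=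
  if ∃ i, inSight G l (P i) rv then some rv else none

/-- The play of the `l`-visibility game: given initial cop positions `init`, a cop
strategy `σ` (a function of the history of observations only), and a robber
trajectory `r`, this returns the cop positions after `t` cop moves together with the
history of observations made so far. -/
noncomputable def visPlay {V : Type} (G : SimpleGraph V) (l : ℕ) {k : ℕ}
    (init : Fin k → V) (σ : List (Option V) → Fin k → V) (r : ℕ → V) :
    ℕ → (Fin k → V) × List (Option V)
  | 0 => (init, [])
  | t + 1 =>
    let prev := visPlay G l init σ r t
    let h := prev.2 ++ [visObs G l prev.1 (r t)]
    (σ h, h)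

/-- Cop positions after `t` cop moves in the `l`-visibility game. -/
noncomputable def visPos {V : Type} (G : SimpleGraph V) (l : ℕ) {k : ℕ}
    (init : Fin k → V) (σ : List (Option V) → Fin k → V) (r : ℕ → V) (t : ℕ) :
    Fin k → V :=
  (visPlay G l init σ r t).1

/-- `k` cops with visibility `l` can guarantee capturing the robber on `G`:
there are initial positions and a strategy (depending only on the cops' observations)
whose moves are always legal and such that, against every legal robber trajectory,
some cop eventually occupies the robber's vertex. -/
def VisCopsCapture {V : Type} (G : SimpleGraph V) (l k : ℕ) : Prop :=
  ∃ (init : Fin k → V) (σ : List (Option V) → Fin k → V),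
    ∀ r : ℕ → V, LegalRobber G r →
      LegalCopPath G (visPos G l init σ r) ∧
      ∃ t i, visPos G l init σ r t i = r t ∨ visPos G l init σ r (t + 1) i = r t

/-- `k` cops with visibility `l` can guarantee seeing the robber on `G`. -/
def VisCopsSee {V : Type} (G : SimpleGraph V) (l k : ℕ) : Prop :=
  ∃ (init : Fin k → V) (σ : List (Option V) → Fin k → V),
    ∀ r : ℕ → V, LegalRobber G r →
      LegalCopPath G (visPos G l init σ r) ∧
      ∃ t i, inSight G l (visPos G l init σ r t i) (r t) ∨
        inSight G l (visPos G l init σ r (t + 1) i) (r t)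

/-- The `l`-visibility capture number `cop_l(G)`. -/
noncomputable def visCaptureNum {V : Type} (G : SimpleGraph V) (l : ℕ) : ℕ :=
  sInf {k | VisCopsCapture G l k}

/-- The `l`-visibility seeing number `cop'_l(G)`. -/
noncomputable def visSeeNum {V : Type} (G : SimpleGraph V) (l : ℕ) : ℕ :=
  sInf {k | VisCopsSee G l k}


/-- The robber evades `m` cops of any visibility if he can start at an unthreatened vertex
and can always move from an unoccupied vertex to an unthreatened one. -/
theorem not_visCopsCapture_of_escape {V : Type} (G : SimpleGraph V) (l m : ℕ)
    (start : ∀ C : Fin m → V, ∃ v, ∀ j, v ≠ C j ∧ ¬ G.Adj (C j) v)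
    (move : ∀ (C : Fin m → V) (v : V), (∀ j, v ≠ C j) →
      ∃ w, (w = v ∨ G.Adj v w) ∧ ∀ j, w ≠ C j ∧ ¬ G.Adj (C j) w) :
    ¬ VisCopsCapture G l m := by
  rintro ⟨init, σ, hσ⟩
  have move' : ∀ (C : Fin m → V) (v : V), ∃ w, (w = v ∨ G.Adj v w) ∧
      ((∀ j, v ≠ C j) → ∀ j, w ≠ C j ∧ ¬ G.Adj (C j) w) := by
    intro C v
    by_cases h : ∀ j, v ≠ C j
    · obtain ⟨w, hw, hw'⟩ := move C v h
      exact ⟨w, hw, fun _ => hw'⟩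
    · exact ⟨v, Or.inl rfl, fun h' => absurd h' h⟩
  choose next next_legal next_safe using move'
  obtain ⟨v₀, hv₀⟩ := start init
  let step : ((Fin m → V) × List (Option V)) × V → ((Fin m → V) × List (Option V)) × V :=
    fun s =>
      let h := s.1.2 ++ [visObs G l s.1.1 s.2]
      ((σ h, h), next (σ h) s.2)
  let state : ℕ → ((Fin m → V) × List (Option V)) × V :=
    fun t => Nat.rec ((init, []), v₀) (fun _ s => step s) t
  let r : ℕ → V := fun t => (state t).2
  have hplay : ∀ t, visPlay G l init σ r t = (state t).1 := by
    intro t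
    induction t with
    | zero => rfl
    | succ t ih =>
      simp only [visPlay, ih]
      rfl
  have hnext : ∀ t, r (t + 1) = next (visPos G l init σ r (t + 1)) (r t) := by
    intro t
    simp only [visPos, hplay]
    rfl
  have hr : LegalRobber G r := by
    intro t
    rw [hnext]
    exact next_legal _ _
  obtain ⟨hlegal, t, i, hcatch⟩ := hσ r hr
  have hmiss : ∀ t, (∀ j, r t ≠ visPos G l init σ r t j ∧
      ¬ G.Adj (visPos G l init σ r t j) (r t)) →
      ∀ j, r t ≠ visPos G l init σ r (t + 1) j := by
    intro t ht j hj
    rcases hlegal t j with h | h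
    · exact (ht j).1 (hj.trans h)
    · exact (ht j).2 (hj ▸ h)
  have hsafe : ∀ t j, r t ≠ visPos G l init σ r t j ∧
      ¬ G.Adj (visPos G l init σ r t j) (r t) := by
    intro t
    induction t with
    | zero => exact hv₀
    | succ t ih =>
      rw [hnext]
      exact next_safe _ _ (hmiss t ih)
  rcases hcatch with h | h
  · exact (hsafe t i).1 h.symm
  · exact hmiss t (hsafe t) i h.symm

/-- As many cops as vertices suffice, whatever the visibility. -/
theorem visCopsCapture_card {V : Type} [Fintype V] (G : SimpleGraph V) (l : ℕ) :
    VisCopsCapture G l (Fintype.card V) := by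
  let e := Fintype.equivFin V
  refine ⟨e.symm, fun _ => e.symm, fun r _ => ⟨fun t i => Or.inl ?_, 0, e (r 0), Or.inl ?_⟩⟩
  · cases t <;> rfl
  · exact e.symm_apply_apply _

/-- A single cop of visibility at least the diameter sees the robber at once. -/
theorem visSeeNum_eq_one {V : Type} (G : SimpleGraph V) (l : ℕ) (c : V)
    (h : ∀ v, inSight G l c v) : visSeeNum G l = 1 := by
  have h1 : VisCopsSee G l 1 := by
    refine ⟨fun _ => c, fun _ _ => c, fun r _ => ⟨fun t i => Or.inl ?_, 0, 0, Or.inl (h _)⟩⟩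
    cases t <;> rfl
  have h0 : ¬ VisCopsSee G l 0 := by
    rintro ⟨_, _, hσ⟩
    obtain ⟨-, -, i, -⟩ := hσ (fun _ => c) (fun _ => Or.inl rfl)
    exact i.elim0
  refine le_antisymm (Nat.sInf_le h1) (le_csInf ⟨1, h1⟩ fun m hm => ?_)
  by_contra hlt
  obtain rfl : m = 0 := by omega
  exact h0 hm

/-- The graph on the affine plane over `ZMod p` joining distinct points on a common line
of slope `0, 1, …, k`. -/
def slopeGraph (p k : ℕ) : SimpleGraph (ZMod p × ZMod p) where
  Adj u v := u ≠ v ∧ ∃ i : Fin (k + 1), v.2 - u.2 = (i : ℕ) * (v.1 - u.1)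
  symm := ⟨fun u v ⟨hne, i, hi⟩ => ⟨hne.symm, i, by linear_combination -hi⟩⟩
  loopless := ⟨fun _ h => h.1 rfl⟩

theorem slopeGraph_exists_walk (p k : ℕ) (hk : 0 < k) (u v : ZMod p × ZMod p) :
    ∃ w : (slopeGraph p k).Walk u v, w.length ≤ 2 := by
  have edge : ∀ (a b : ZMod p × ZMod p) (i : Fin (k + 1)),
      b.2 - a.2 = (i : ℕ) * (b.1 - a.1) → ∃ w : (slopeGraph p k).Walk a b, w.length ≤ 1 := by
    intro a b i hi
    by_cases hab : a = b
    · subst hab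
      exact ⟨.nil, by simp⟩
    · have hadj : (slopeGraph p k).Adj a b := ⟨hab, i, hi⟩
      exact ⟨hadj.toWalk, by simp⟩
  obtain ⟨w₁, h₁⟩ := edge u (v.1 + (u.2 - v.2), u.2) ⟨0, by omega⟩ (by simp)
  obtain ⟨w₂, h₂⟩ := edge (v.1 + (u.2 - v.2), u.2) v ⟨1, by omega⟩ (by simp)
  exact ⟨w₁.append w₂, by rw [SimpleGraph.Walk.length_append]; omega⟩

theorem slopeGraph_escape {p k m : ℕ} [Fact p.Prime] (hp : k * (k + 1) < p) (hm : m ≤ k)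
    (C : Fin m → ZMod p × ZMod p) (v : ZMod p × ZMod p) (hv : ∀ j, v ≠ C j) :
    ∃ w, (w = v ∨ (slopeGraph p k).Adj v w) ∧
      ∀ j, w ≠ C j ∧ ¬ (slopeGraph p k).Adj (C j) w := by
  have slope_inj : ∀ i i' : Fin (k + 1), ((i : ℕ) : ZMod p) = ((i' : ℕ) : ZMod p) → i = i' := by
    intro i i' h
    have hkp : k + 1 ≤ p := by nlinarith
    have := (ZMod.natCast_eq_natCast_iff' _ _ _).1 h
    rw [Nat.mod_eq_of_lt (by omega), Nat.mod_eq_of_lt (by omega)] at this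
    exact Fin.ext this
  -- Each cop lies on at most one of the `k + 1` lines through `v`, so some line is free.
  obtain ⟨s, hs⟩ : ∃ s : Fin (k + 1), ∀ j, (C j).2 - v.2 ≠ (s : ℕ) * ((C j).1 - v.1) := by
    by_contra! hcov
    choose f hf using hcov
    have finj : Function.Injective f := by
      intro s s' h
      have h₁ := hf s
      have h₂ := hf s'
      rw [← h] at h₂
      apply slope_inj
      have hmul : (((s : ℕ) : ZMod p) - (s' : ℕ)) * ((C (f s)).1 - v.1) = 0 := by
        linear_combination h₂ - h₁
      rcases mul_eq_zero.1 hmul with h0 | h0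
      · exact sub_eq_zero.1 h0
      · rw [h0, mul_zero] at h₁
        exact absurd (Prod.ext (sub_eq_zero.1 h0) (sub_eq_zero.1 h₁)).symm (hv _)
    have := Fintype.card_le_of_injective f finj
    simp only [Fintype.card_fin] at this
    omega
  -- Every line through a cop in another direction meets the free line in one point.
  let bad : Fin m × Fin (k + 1) → ZMod p := fun q =>
    ((q.2 : ℕ) * (v.1 - (C q.1).1) - (v.2 - (C q.1).2)) / ((s : ℕ) - (q.2 : ℕ))
  obtain ⟨x, hx⟩ : ∃ x, ∀ q, bad q ≠ x := by
    by_contra! hsurj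
    have := Fintype.card_le_of_surjective bad hsurj
    simp only [Fintype.card_prod, Fintype.card_fin, ZMod.card] at this
    nlinarith
  refine ⟨(v.1 + x, v.2 + (s : ℕ) * x), ?_, fun j => ⟨fun h => hs j ?_, ?_⟩⟩
  · by_cases h : v = (v.1 + x, v.2 + (s : ℕ) * x)
    · exact Or.inl h.symm
    · exact Or.inr ⟨h, s, by simp⟩
  · rw [← h]
    ring
  · rintro ⟨-, i, hi⟩
    simp only at hi
    by_cases his : s = i
    · subst his
      exact hs j (by linear_combination -hi)
    · have hne : ((s : ℕ) : ZMod p) - (i : ℕ) ≠ 0 :=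
        fun h => his (slope_inj _ _ (sub_eq_zero.1 h))
      apply hx (j, i)
      simp only [bad]
      rw [div_eq_iff hne]
      linear_combination -hi

/-- For every integer `l ≥ 2` and every positive integer `k`, there
exists a finite connected simple graph `G` with `cop'_l(G) = 1` and
`cop_l(G) ≥ k + 1`; in particular `cop_l(G) - cop'_l(G) ≥ k`. -/
theorem cost_of_capture_large_visibility (l k : ℕ) (hl : 2 ≤ l) (hk : 0 < k) :
    ∃ (V : Type) (_ : Fintype V) (G : SimpleGraph V),
      G.Connected ∧ visSeeNum G l = 1 ∧ k + 1 ≤ visCaptureNum G l := by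
  obtain ⟨p, hp, hprime⟩ := Nat.exists_infinite_primes (k * (k + 1) + 1)
  have : Fact p.Prime := ⟨hprime⟩
  refine ⟨ZMod p × ZMod p, inferInstance, slopeGraph p k, ?_, ?_, ?_⟩
  · exact ⟨fun u v => ⟨(slopeGraph_exists_walk p k hk u v).choose⟩⟩
  · refine visSeeNum_eq_one _ l 0 fun v => ?_
    obtain ⟨w, hw⟩ := slopeGraph_exists_walk p k hk 0 v
    exact ⟨⟨w⟩, (SimpleGraph.dist_le w).trans (hw.trans hl)⟩
  · refine le_csInf ⟨_, visCopsCapture_card _ l⟩ fun m hm => ?_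
    by_contra hlt
    have hmk : m ≤ k := by omega
    refine not_visCopsCapture_of_escape _ l m (fun C => ?_)
      (slopeGraph_escape (by omega) hmk) hm
    obtain ⟨v, hv⟩ : ∃ v, ∀ j, C j ≠ v := by
      by_contra! hsurj
      have := Fintype.card_le_of_surjective C hsurj
      simp only [Fintype.card_prod, Fintype.card_fin, ZMod.card] at this
      have hpp : p ≤ p * p := Nat.le_mul_self p
      have hkk : k ≤ k * (k + 1) := Nat.le_mul_of_pos_right k k.succ_pos
      omega
    obtain ⟨w, -, hw⟩ := slopeGraph_escape (by omega) hmk C v fun j => (hv j).symm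
    exact ⟨w, hw⟩
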